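/- Let A be a unital C*-algebra, H a complex Hilbert space, and φ : A → B(H) a linear map. Then the following are equivalent: (1) φ is a unital completely bounded linear map; (2) there exist a complex Hilbert space K, a unital *-representation π : A → B(K), and bounded operators X : K → H and Y : H → K such that XY = I_H and φ(a) = Xπ(a)Y for every a ∈ A. -/

import Mathlib

open scoped Matrix

noncomputable section

/-- The C*-norm of a square matrix over a (possibly non-unital) C*-algebra `A`, defined
intrinsically via the spectral radius in the unitization: `‖x‖ = √(spectralRadius ℂ (xᴴ * x))`.
This agrees with the unique C*-norm on `Mₙ(A)`. -/
def cstarMatrixNorm {A : Type*} [NonUnitalCStarAlgebra A] {n : ℕ}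
    (x : Matrix (Fin n) (Fin n) A) : ℝ :=
  Real.sqrt ((spectralRadius ℂ
    ((x.map (Unitization.inr : A → Unitization ℂ A))ᴴ *
      x.map (Unitization.inr : A → Unitization ℂ A))).toReal)

/-- A map between C*-algebras is *completely bounded* if the norms of its amplifications
`φ⁽ⁿ⁾ : Mₙ(A) → Mₙ(B)`, `(aᵢⱼ) ↦ (φ(aᵢⱼ))`, are uniformly bounded. -/
def CompletelyBounded {A B : Type*} [NonUnitalCStarAlgebra A] [NonUnitalCStarAlgebra B]
    (φ : A → B) : Prop :=
  ∃ C : ℝ, ∀ (n : ℕ) (x : Matrix (Fin n) (Fin n) A),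
    cstarMatrixNorm (x.map φ) ≤ C * cstarMatrixNorm x

/-- Positivity of a square matrix over a C*-algebra: `x ≥ 0` iff `x = yᴴ * y` for some `y`. -/
def MatIsPos {B : Type*} [NonUnitalSemiring B] [StarRing B] {n : ℕ}
    (x : Matrix (Fin n) (Fin n) B) : Prop :=
  ∃ y : Matrix (Fin n) (Fin n) B, x = yᴴ * y

/-- A map between C*-algebras is *completely positive* if all of its amplifications
`(aᵢⱼ) ↦ (φ(aᵢⱼ))` map positive matrices to positive matrices. -/
def CompletelyPositive {A B : Type*} [NonUnitalSemiring A] [StarRing A]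
    [NonUnitalSemiring B] [StarRing B] (φ : A → B) : Prop :=
  ∀ (n : ℕ) (x : Matrix (Fin n) (Fin n) A), MatIsPos x → MatIsPos (x.map φ)

/-- A map between C*-algebras is a `*`-representation if it is multiplicative and
star-preserving (linearity/boundedness are imposed on the ambient data separately). -/
def IsStarRep {A B : Type*} [Mul A] [Star A] [Mul B] [Star B] (ψ : A → B) : Prop :=
  (∀ a b, ψ (a * b) = ψ a * ψ b) ∧ ∀ a, ψ (star a) = star (ψ a)

/-- A factorization `φ(a) = X π(a) Y` of a map `φ : A → B(H)` through a unital
`*`-representation `π` of `A` on a Hilbert space `K`, with bounded operators `X : K → H`,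
`Y : H → K` satisfying `XY = I`. -/
structure RepFactorization.{u, v} (A : Type u) [CStarAlgebra A]
    (H : Type v) [NormedAddCommGroup H] [InnerProductSpace ℂ H] [CompleteSpace H]
    (φ : A →ₗ[ℂ] (H →L[ℂ] H)) : Type (max u v + 1) where
  K : Type (max u v)
  [instNormed : NormedAddCommGroup K]
  [instInner : InnerProductSpace ℂ K]
  [instComplete : CompleteSpace K]
  π : A →L[ℂ] (K →L[ℂ] K)
  X : K →L[ℂ] H
  Y : H →L[ℂ] K
  unital : π 1 = 1
  starRep : IsStarRep (⇑π)
  comp_eq_id : X ∘L Y = ContinuousLinearMap.id ℂ H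
  factor : ∀ a : A, φ a = X ∘L ((π a) ∘L Y)


section Norms

theorem cstarMatrixNorm_eq_norm {A : Type*} [CStarAlgebra A] [PartialOrder A] [StarOrderedRing A]
    {n : ℕ} (x : Matrix (Fin n) (Fin n) A) :
    cstarMatrixNorm x = ‖CStarMatrix.ofMatrix x‖ := by
  rw [← NonUnitalStarAlgHom.norm_map
    (CStarMatrix.mapₙₐ (n := Fin n) (Unitization.inrNonUnitalStarAlgHom ℂ A))
    (fun a b hab => CStarMatrix.map_injective Unitization.inr_injective hab)
    (CStarMatrix.ofMatrix x)]
  exact CStarAlgebra.sqrt_toReal_spectralRadius_star_mul_self_eq_norm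
    (CStarMatrix.mapₙₐ (n := Fin n) (Unitization.inrNonUnitalStarAlgHom ℂ A)
      (CStarMatrix.ofMatrix x))

variable {n : Type*} [Fintype n]
  {H : Type*} [NormedAddCommGroup H] [InnerProductSpace ℂ H] [CompleteSpace H]

/-- A matrix of operators on `H`, acting on the Hilbert sum `Hⁿ`. -/
def matrixOperator (Z : CStarMatrix n n (H →L[ℂ] H)) :
    PiLp 2 (fun _ : n => H) →L[ℂ] PiLp 2 (fun _ : n => H) :=
  (PiLp.continuousLinearEquiv 2 ℂ (fun _ : n => H)).symm.toContinuousLinearMap ∘L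
    ContinuousLinearMap.pi fun i => ∑ j, Z i j ∘L PiLp.proj 2 (fun _ : n => H) j

omit [CompleteSpace H] in
@[simp]
theorem matrixOperator_apply (Z : CStarMatrix n n (H →L[ℂ] H))
    (ξ : PiLp 2 (fun _ : n => H)) (i : n) :
    matrixOperator Z ξ i = ∑ j, Z i j (ξ j) := by
  simp [matrixOperator]

omit [CompleteSpace H] in
theorem inner_matrixOperator (Z : CStarMatrix n n (H →L[ℂ] H)) (η ξ : PiLp 2 (fun _ : n => H)) :
    inner ℂ η (matrixOperator Z ξ) = ∑ i, ∑ j, inner ℂ (η i) (Z i j (ξ j)) := by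
  simp [PiLp.inner_apply, inner_sum]

/-- The action of `Mₙ(B(H))` on `Hⁿ` as a `*`-homomorphism. -/
def matrixOperatorHom : CStarMatrix n n (H →L[ℂ] H) →⋆ₙₐ[ℂ]
    (PiLp 2 (fun _ : n => H) →L[ℂ] PiLp 2 (fun _ : n => H)) where
  toFun Z := matrixOperator Z
  map_smul' c Z := by
    ext ξ i
    simp [Finset.smul_sum]
  map_zero' := by
    ext ξ i
    simp
  map_add' Z W := by
    ext ξ i
    simp [Finset.sum_add_distrib]
  map_mul' Z W := by
    ext ξ i
    simp only [matrixOperator_apply, mul_apply_eq_comp, CStarMatrix.mul_apply,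
      sum_apply, map_sum]
    exact Finset.sum_comm
  map_star' Z := by
    refine (ContinuousLinearMap.eq_adjoint_iff _ _).mpr fun ξ η => ?_
    rw [inner_matrixOperator, ← inner_conj_symm, inner_matrixOperator]
    simp only [map_sum]
    rw [Finset.sum_comm]
    refine Finset.sum_congr rfl fun i _ => Finset.sum_congr rfl fun j _ => ?_
    rw [CStarMatrix.star_apply, ContinuousLinearMap.star_eq_adjoint, inner_conj_symm,
      ContinuousLinearMap.adjoint_inner_left]

theorem matrixOperatorHom_injective :
    Function.Injective (matrixOperatorHom (n := n) (H := H)) := by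
  classical
  refine (injective_iff_map_eq_zero _).mpr fun Z hZ => ?_
  ext i j h
  have := congrArg (fun T => T (WithLp.toLp 2 (Pi.single j h)) i) hZ
  change matrixOperator Z _ i = 0 at this
  rw [matrixOperator_apply, Finset.sum_eq_single j (by simp +contextual)
    (by simp)] at this
  simpa using this

theorem norm_matrixOperator (Z : CStarMatrix n n (H →L[ℂ] H)) : ‖matrixOperator Z‖ = ‖Z‖ :=
  NonUnitalStarAlgHom.norm_map matrixOperatorHom matrixOperatorHom_injective Z

theorem norm_sum_inner_le (Z : CStarMatrix n n (H →L[ℂ] H)) (η ξ : n → H) :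
    ‖∑ i, ∑ j, inner ℂ (η i) (Z i j (ξ j))‖ ≤
      ‖Z‖ * √(∑ i, ‖η i‖ ^ 2) * √(∑ i, ‖ξ i‖ ^ 2) := by
  have h := inner_matrixOperator Z (WithLp.toLp 2 η) (WithLp.toLp 2 ξ)
  simp only at h
  rw [← h]
  refine (norm_inner_le_norm _ _).trans ?_
  grw [ContinuousLinearMap.le_opNorm]
  rw [norm_matrixOperator, PiLp.norm_eq_of_L2, PiLp.norm_eq_of_L2]
  exact le_of_eq (by ring)

theorem norm_le_of_forall_sum_inner_le (Z : CStarMatrix n n (H →L[ℂ] H)) {c : ℝ} (hc : 0 ≤ c)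
    (h : ∀ η ξ : n → H, ‖∑ i, ∑ j, inner ℂ (η i) (Z i j (ξ j))‖ ≤
      c * √(∑ i, ‖η i‖ ^ 2) * √(∑ i, ‖ξ i‖ ^ 2)) : ‖Z‖ ≤ c := by
  rw [← norm_matrixOperator]
  refine ContinuousLinearMap.opNorm_le_of_re_inner_le hc fun ξ η hξ hη => ?_
  calc RCLike.re (inner ℂ (matrixOperator Z ξ) η) ≤ ‖inner ℂ η (matrixOperator Z ξ)‖ := by
        rw [norm_inner_symm]
        exact RCLike.re_le_norm _
    _ ≤ c * ‖η‖ * ‖ξ‖ := by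
        rw [inner_matrixOperator, PiLp.norm_eq_of_L2, PiLp.norm_eq_of_L2]
        exact h _ _
    _ = c := by rw [hξ, hη, mul_one, mul_one]

end Norms

section CompletelyBounded

variable {A : Type*} [CStarAlgebra A] [PartialOrder A] [StarOrderedRing A]
  {H : Type*} [NormedAddCommGroup H] [InnerProductSpace ℂ H] [CompleteSpace H]

theorem norm_sum_inner_le_of_cstarMatrixNorm_le {φ : A → H →L[ℂ] H} {C : ℝ}
    (hφ : ∀ (n : ℕ) (x : Matrix (Fin n) (Fin n) A),
      cstarMatrixNorm (x.map φ) ≤ C * cstarMatrixNorm x)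
    {n : Type*} [Fintype n] (y : CStarMatrix n n A) (η ξ : n → H) :
    ‖∑ i, ∑ j, inner ℂ (η i) (φ (y i j) (ξ j))‖ ≤
      C * ‖y‖ * √(∑ i, ‖η i‖ ^ 2) * √(∑ i, ‖ξ i‖ ^ 2) := by
  let e := (Fintype.equivFin n).symm
  let y' : CStarMatrix (Fin (Fintype.card n)) (Fin (Fintype.card n)) A :=
    CStarMatrix.reindexₐ ℂ A e.symm y
  have hy : ‖y'‖ = ‖y‖ :=
    NonUnitalStarAlgHom.norm_map (CStarMatrix.reindexₐ ℂ A e.symm)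
      (CStarMatrix.reindexₐ ℂ A e.symm).injective y
  have hb := hφ _ (CStarMatrix.ofMatrix.symm y')
  rw [cstarMatrixNorm_eq_norm, cstarMatrixNorm_eq_norm, Equiv.apply_symm_apply, hy] at hb
  have h := norm_sum_inner_le (y'.map φ) (η ∘ e) (ξ ∘ e)
  have hsum : ∑ i, ∑ j, inner ℂ ((η ∘ e) i) (y'.map φ i j ((ξ ∘ e) j)) =
      ∑ i, ∑ j, inner ℂ (η i) (φ (y i j) (ξ j)) :=
    Fintype.sum_equiv e _ _ fun i => Fintype.sum_equiv e _ _ fun j => rfl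
  rw [hsum] at h
  simp only [Function.comp_apply, e.sum_comp fun i => ‖η i‖ ^ 2,
    e.sum_comp fun i => ‖ξ i‖ ^ 2] at h
  exact h.trans (by gcongr; exact hb)

end CompletelyBounded

namespace RepFactorization

attribute [local instance] instNormed instInner instComplete

variable {A : Type*} [CStarAlgebra A]
  {H : Type*} [NormedAddCommGroup H] [InnerProductSpace ℂ H] [CompleteSpace H]
  {φ : A →ₗ[ℂ] (H →L[ℂ] H)}

theorem map_one (R : RepFactorization A H φ) : φ 1 = 1 := by
  rw [R.factor, R.unital]
  exact R.comp_eq_id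

/-- The representation of a `RepFactorization` as a `*`-homomorphism. -/
def starHom (R : RepFactorization A H φ) : A →⋆ₙₐ[ℂ] (R.K →L[ℂ] R.K) where
  toFun := R.π
  map_smul' := R.π.map_smul
  map_zero' := R.π.map_zero
  map_add' := R.π.map_add
  map_mul' := R.starRep.1
  map_star' := R.starRep.2

theorem completelyBounded (R : RepFactorization A H φ) : CompletelyBounded φ := by
  let := CStarAlgebra.spectralOrder A
  have := CStarAlgebra.spectralOrderedRing A
  refine ⟨‖R.X‖ * ‖R.Y‖, fun n x => ?_⟩
  have key : ∀ {E F : Type _} [NormedAddCommGroup E] [InnerProductSpace ℂ E]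
      [NormedAddCommGroup F] [InnerProductSpace ℂ F] (T : E →L[ℂ] F) (ξ : Fin n → E),
      √(∑ i, ‖T (ξ i)‖ ^ 2) ≤ ‖T‖ * √(∑ i, ‖ξ i‖ ^ 2) := by
    intro E F _ _ _ _ T ξ
    refine Real.sqrt_le_iff.mpr ⟨by positivity, ?_⟩
    rw [mul_pow, Real.sq_sqrt (by positivity), Finset.mul_sum]
    refine Finset.sum_le_sum fun i _ => ?_
    rw [← mul_pow]
    gcongr
    exact T.le_opNorm _
  rw [cstarMatrixNorm_eq_norm, cstarMatrixNorm_eq_norm]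
  refine norm_le_of_forall_sum_inner_le _ (by positivity) fun η ξ => ?_
  have hπ := norm_sum_inner_le (CStarMatrix.mapₙₐ R.starHom (CStarMatrix.ofMatrix x))
    (fun i => ContinuousLinearMap.adjoint R.X (η i)) (fun i => R.Y (ξ i))
  have hle := NonUnitalStarAlgHom.norm_apply_le
    (CStarMatrix.mapₙₐ (n := Fin n) R.starHom) (CStarMatrix.ofMatrix x)
  calc _ = ‖∑ i, ∑ j, inner ℂ (ContinuousLinearMap.adjoint R.X (η i))
        (CStarMatrix.mapₙₐ R.starHom (CStarMatrix.ofMatrix x) i j (R.Y (ξ j)))‖ := by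
        congr! 5 with i _ j _
        simp only [CStarMatrix.ofMatrix_apply, Matrix.map_apply, R.factor,
          ContinuousLinearMap.adjoint_inner_left]
        rfl
    _ ≤ _ := hπ
    _ ≤ ‖CStarMatrix.ofMatrix x‖ * (‖R.X‖ * √(∑ i, ‖η i‖ ^ 2)) *
        (‖R.Y‖ * √(∑ i, ‖ξ i‖ ^ 2)) := by
        gcongr
        · simpa using key (ContinuousLinearMap.adjoint R.X) η
        · exact key R.Y ξ
    _ = _ := by ring

end RepFactorization

section HermitianExtension

/-- A complex version of the M. Riesz extension theorem: a functional prescribed on a subspace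
`P`, up to symmetrization by the involution `σ`, extends to a hermitian functional that is
nonnegative on the convex cone `C` of hermitian elements. -/
theorem exists_hermitian_extension {E : Type*} [AddCommGroup E] [Module ℂ E]
    (σ : E →ₗ⋆[ℂ] E) (hσ : ∀ x, σ (σ x) = x) (C : AddSubmonoid E)
    (hCr : ∀ r : ℝ, 0 ≤ r → ∀ z ∈ C, (r : ℂ) • z ∈ C) (hC : ∀ z ∈ C, σ z = z)
    (P : Submodule ℂ E) (G : E →ₗ[ℂ] ℂ)
    (hσP : ∀ x ∈ P, σ x ∈ P) (hG : ∀ z ∈ P, z ∈ C → 0 ≤ (G z).re)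
    (hP : ∀ y, ∃ x ∈ P, x + σ x + (y + σ y) ∈ C) :
    ∃ F : E →ₗ[ℂ] ℂ, (∀ x ∈ P, F x = G x + star (G (σ x))) ∧ (∀ z ∈ C, 0 ≤ (F z).re) ∧
      ∀ x, F (σ x) = star (F x) := by
  have hσr (r : ℝ) (x : E) : σ (r • x) = r • σ x := by
    rw [← Complex.coe_smul, map_smulₛₗ, Complex.conj_ofReal, Complex.coe_smul]
  let s : PointedCone ℝ E :=
    { carrier := {x | x + σ x ∈ C}
      add_mem' := fun {x y} hx hy => by
        have := C.add_mem hx hy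
        simp only [Set.mem_ofPred_eq, map_add]
        convert this using 1
        abel
      zero_mem' := by simp
      smul_mem' := fun c x hx => by
        have := hCr c c.2 _ hx
        rw [Complex.coe_smul, smul_add, ← hσr] at this
        exact this }
  let f₀ : E →ₗ[ℝ] ℝ :=
    { toFun := fun x => (G x).re + (G (σ x)).re
      map_add' := fun x y => by
        simp only [map_add, Complex.add_re]
        ring
      map_smul' := fun r x => by
        rw [hσr, ← Complex.coe_smul, ← Complex.coe_smul, map_smul, map_smul]
        simp
        ring }
  obtain ⟨g, hgf, hgs⟩ := riesz_extension s ⟨P.restrictScalars ℝ, f₀.domRestrict _⟩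
    (fun x hx => by
      have h := hG (x + σ x) (P.add_mem x.2 (hσP _ x.2)) hx
      rw [map_add, Complex.add_re] at h
      exact h)
    (fun y => by
      obtain ⟨x, hx, hxy⟩ := hP y
      refine ⟨⟨x, hx⟩, ?_⟩
      change x + y + σ (x + y) ∈ C
      rw [map_add]
      convert hxy using 1
      abel)
  have hgσ (x : E) : g (σ x) = g x := by
    have h1 := hgs (x - σ x) (by change _ + σ _ ∈ C; simp [hσ])
    have h2 := hgs (σ x - x) (by change _ + σ _ ∈ C; simp [hσ])
    rw [map_sub] at h1 h2
    linarith
  have hF (x : E) : Module.Dual.extendRCLike (𝕜 := ℂ) g x =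
      (g x : ℂ) - Complex.I * g (Complex.I • x) := Module.Dual.extendRCLike_apply g x
  have hgP (x : E) (hx : x ∈ P) : g x = (G x).re + (G (σ x)).re := hgf ⟨x, hx⟩
  refine ⟨Module.Dual.extendRCLike (𝕜 := ℂ) g, fun x hx => ?_, fun z hz => ?_, fun x => ?_⟩
  · rw [hF, hgP x hx, hgP _ (P.smul_mem _ hx)]
    apply Complex.ext <;> simp
    ring
  · have h := hgs z (by
      change z + σ z ∈ C
      rw [hC z hz]
      exact C.add_mem hz hz)
    simpa [hF] using h
  · have h : g (Complex.I • σ x) = - g (Complex.I • x) := by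
      rw [← hgσ (Complex.I • x), σ.map_smulₛₗ, Complex.conj_I, neg_smul, map_neg, neg_neg]
    rw [hF, hF, hgσ, h]
    apply Complex.ext <;> simp

end HermitianExtension

section GNS

/-- The GNS construction for a positive semidefinite form on an `A`-module. -/
theorem exists_starAlgHom_of_form.{u, w} {A : Type u} [CStarAlgebra A]
    {V : Type w} [AddCommGroup V] [Module ℂ V] [Module A V] [IsScalarTower ℂ A V]
    (p : V →ₗ⋆[ℂ] V →ₗ[ℂ] ℂ) (hp : ∀ u, 0 ≤ (p u u).re) (hsymm : ∀ u v, star (p v u) = p u v)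
    (hA : ∀ (a : A) u v, p u (a • v) = p (star a • u) v) :
    ∃ (K : Type w) (_ : NormedAddCommGroup K) (_ : InnerProductSpace ℂ K) (_ : CompleteSpace K)
      (π : A →⋆ₐ[ℂ] (K →L[ℂ] K)) (j : V →ₗ[ℂ] K),
      (∀ u v, inner ℂ (j u) (j v) = p u v) ∧ ∀ a u, π a (j u) = j (a • u) := by
  let core : PreInnerProductSpace.Core ℂ V :=
    { inner := fun u v => p u v
      conj_inner_symm := fun u v => hsymm u v
      re_inner_nonneg := hp
      add_left := fun u v w => by simp
      smul_left := fun u v c => by simp }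
  let : SeminormedAddCommGroup V := InnerProductSpace.Core.toSeminormedAddCommGroup (c := core)
  let : InnerProductSpace ℂ V := InnerProductSpace.ofCore core
  have inner_eq (u v : V) : inner ℂ u v = p u v := rfl
  have norm_sq (u : V) : ‖u‖ ^ 2 = (p u u).re := by
    rw [← inner_eq]; exact norm_sq_eq_re_inner (𝕜 := ℂ) u
  have bound (a : A) (u : V) : ‖a • u‖ ≤ ‖a‖ * ‖u‖ := by
    rw [← sq_le_sq₀ (by positivity) (by positivity), mul_pow, norm_sq, norm_sq]
    let := CStarAlgebra.spectralOrder A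
    have := CStarAlgebra.spectralOrderedRing A
    have h0 : 0 ≤ algebraMap ℝ A (‖a‖ ^ 2) - star a * a := by
      rw [sub_nonneg]
      exact CStarAlgebra.star_mul_le_algebraMap_norm_sq
    obtain ⟨c, hc⟩ := CStarAlgebra.nonneg_iff_eq_star_mul_self.mp h0
    have h1 := hp (c • u)
    rw [hA, ← mul_smul, ← hc, sub_smul, map_sub, LinearMap.sub_apply, mul_smul, ← hA] at h1
    have h2 : algebraMap ℝ A (‖a‖ ^ 2) • u = ((‖a‖ ^ 2 : ℝ) : ℂ) • u := by
      rw [← algebraMap_smul A ((‖a‖ ^ 2 : ℝ) : ℂ) u]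
      rfl
    rw [h2, map_smulₛₗ] at h1
    simpa [-Complex.ofReal_pow] using h1
  let L (a : A) : V →L[ℂ] V :=
    LinearMap.mkContinuous
      { toFun := fun u => a • u
        map_add' := smul_add a
        map_smul' := fun c u => smul_comm a c u } ‖a‖ (bound a)
  have L_apply (a : A) (u : V) : L a u = a • u := rfl
  let π : A →⋆ₐ[ℂ] (UniformSpace.Completion V →L[ℂ] UniformSpace.Completion V) :=
    { toFun := fun a => (L a).completion
      map_one' := by
        ext c
        induction c using UniformSpace.Completion.induction_on with
        | hp => apply isClosed_eq <;> fun_prop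
        | ih c => simp [L_apply]
      map_zero' := by
        ext c
        induction c using UniformSpace.Completion.induction_on with
        | hp => apply isClosed_eq <;> fun_prop
        | ih c => simpa [L_apply] using UniformSpace.Completion.coe_zero
      commutes' := fun r => by
        ext c
        induction c using UniformSpace.Completion.induction_on with
        | hp => apply isClosed_eq <;> fun_prop
        | ih c => simp [L_apply]
      map_add' := fun a b => by
        ext c
        induction c using UniformSpace.Completion.induction_on with
        | hp => apply isClosed_eq <;> fun_prop
        | ih c => simp [L_apply, add_smul, UniformSpace.Completion.coe_add]
      map_mul' := fun a b => by
        ext c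
        induction c using UniformSpace.Completion.induction_on with
        | hp => apply isClosed_eq <;> fun_prop
        | ih c => simp [L_apply, mul_smul]
      map_star' := fun a => by
        refine (ContinuousLinearMap.eq_adjoint_iff _ _).mpr fun x y => ?_
        induction x, y using UniformSpace.Completion.induction_on₂ with
        | hp => apply isClosed_eq <;> fun_prop
        | ih x y => simp [L_apply, inner_eq, hA] }
  refine ⟨UniformSpace.Completion V, inferInstance, inferInstance, inferInstance, π,
    (UniformSpace.Completion.toComplₗᵢ (𝕜 := ℂ) (E := V)).toLinearMap, fun u v => ?_, fun a u => ?_⟩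
  · simp [inner_eq]
  · simp [π, L_apply]

end GNS

section OffDiagonal

/-- The Cauchy–Schwarz inequality in a C⋆-algebra. -/
theorem norm_sum_star_mul_le {M ι : Type*} [CStarAlgebra M] [Fintype ι] (a b : ι → M) :
    ‖∑ t, star (a t) * b t‖ ≤ √‖∑ t, star (a t) * a t‖ * √‖∑ t, star (b t) * b t‖ := by
  let := CStarAlgebra.spectralOrder M
  have := CStarAlgebra.spectralOrderedRing M
  have h := CStarModule.norm_inner_le (A := M) (WithCStarModule M (ι → M))
    (x := (WithCStarModule.equiv M (ι → M)).symm fun t => star (b t))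
    (y := (WithCStarModule.equiv M (ι → M)).symm fun t => star (a t))
  rw [WithCStarModule.pi_norm, WithCStarModule.pi_norm, WithCStarModule.pi_inner] at h
  simpa [WithCStarModule.inner_def, mul_comm] using h

open scoped MatrixOrder ComplexOrder in
theorem Matrix.PosSemidef.exists_conjTranspose_mul_self_eq_add {n : Type*} [Fintype n]
    [DecidableEq n] {P : Matrix n n ℂ} (hP : P.PosSemidef) {ε : ℝ} (hε : 0 < ε) :
    ∃ S S' : Matrix n n ℂ, Sᴴ * S = P + (ε : ℂ) • 1 ∧ S * S' = 1 ∧ S' * S = 1 := by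
  have h : (P + (ε : ℂ) • 1).PosDef :=
    Matrix.PosDef.posSemidef_add hP (Matrix.PosDef.one.smul (by exact_mod_cast hε))
  obtain ⟨S, hS⟩ := CStarAlgebra.nonneg_iff_eq_star_mul_self.mp h.posSemidef.nonneg
  have hu : IsUnit (star S * S) := hS ▸ h.isUnit
  have hdet : IsUnit S.det := by
    rw [Matrix.isUnit_iff_isUnit_det, Matrix.det_mul] at hu
    exact isUnit_of_mul_isUnit_right hu
  exact ⟨S, S⁻¹, hS.symm, Matrix.mul_nonsing_inv _ hdet, Matrix.nonsing_inv_mul _ hdet⟩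

variable {A : Type*} [CStarAlgebra A] {n : Type*} [Fintype n]

open scoped ComplexOrder in
theorem posSemidef_of_sum_star_mul_eq_algebraMap [Nontrivial A] {m : Type*} [Fintype m]
    {v : m → n → A} {P : Matrix n n ℂ}
    (hP : ∀ i j, ∑ t, star (v t i) * v t j = algebraMap ℂ A (P i j)) : P.PosSemidef := by
  let := CStarAlgebra.spectralOrder A
  have := CStarAlgebra.spectralOrderedRing A
  have key (x : n → ℂ) : algebraMap ℂ A (star x ⬝ᵥ (P *ᵥ x)) =
      ∑ t, star (∑ i, x i • v t i) * ∑ i, x i • v t i := by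
    simp only [dotProduct, Matrix.mulVec, map_sum, map_mul, ← hP, star_sum, star_smul,
      Finset.sum_mul, Finset.mul_sum, Pi.star_apply, Algebra.algebraMap_eq_smul_one,
      smul_mul_assoc, mul_smul_comm, one_mul, mul_one]
    simp only [Finset.smul_sum]
    rw [Finset.sum_comm_cycle]
    exact Finset.sum_congr rfl fun _ _ => Finset.sum_comm
  refine Matrix.PosSemidef.of_dotProduct_mulVec_nonneg ?_ fun x => ?_
  · ext i j
    apply FaithfulSMul.algebraMap_injective ℂ A
    rw [Matrix.conjTranspose_apply, ← hP i j, algebraMap_star_comm, ← hP j i]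
    simp
  · have h : 0 ≤ algebraMap ℂ A (star x ⬝ᵥ (P *ᵥ x)) := by
      rw [key]
      exact Finset.sum_nonneg fun t _ => star_mul_self_nonneg _
    exact spectrum_nonneg_of_nonneg h (by rw [spectrum.scalar_eq]; rfl)

theorem sum_star_sum_smul_mul_sum_smul {m : Type*} [Fintype m] (v w : m → n → A) (a b : n → ℂ) :
    ∑ t, star (∑ i, a i • v t i) * ∑ j, b j • w t j =
      ∑ i, ∑ j, (star (a i) * b j) • ∑ t, star (v t i) * w t j := by
  simp only [star_sum, star_smul, Finset.sum_mul, Finset.mul_sum, smul_mul_assoc, mul_smul_comm,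
    Finset.smul_sum, smul_smul]
  rw [Finset.sum_comm_cycle (γ := m)]
  refine Finset.sum_congr rfl fun _ _ => ?_
  rw [Finset.sum_comm]
  simp only [mul_comm]

/-- The square matrix with `v` as the row of index `r`, and zeros elsewhere. -/
def rowMatrix [DecidableEq n] (r : n) (v : n → A) : CStarMatrix n n A :=
  CStarMatrix.ofMatrix (Matrix.of (Pi.single r v))

theorem star_rowMatrix_mul_rowMatrix [DecidableEq n] (r : n) (v w : n → A) :
    star (rowMatrix r v) * rowMatrix r w =
      CStarMatrix.ofMatrix (Matrix.of fun i j => star (v i) * w j) := by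
  ext i j
  simp only [CStarMatrix.mul_apply, CStarMatrix.star_apply, rowMatrix, CStarMatrix.ofMatrix_apply,
    Matrix.of_apply]
  rw [Finset.sum_eq_single r (fun k _ hk => by simp [Pi.single_eq_of_ne hk]) (by simp)]
  simp

theorem sum_star_rowMatrix_mul_rowMatrix [DecidableEq n] (r : n) {m : Type*} [Fintype m]
    (v w : m → n → A) :
    ∑ t, star (rowMatrix r (v t)) * rowMatrix r (w t) =
      CStarMatrix.ofMatrix (Matrix.of fun i j => ∑ t, star (v t i) * w t j) := by
  simp only [star_rowMatrix_mul_rowMatrix]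
  ext i j
  exact Matrix.sum_apply i j Finset.univ fun t => Matrix.of fun i j => star (v t i) * w t j

variable [PartialOrder A] [StarOrderedRing A]

theorem norm_sum_star_rowMatrix_mul_self_le_one [DecidableEq n] (r : n) {m : Type*} [Fintype m]
    {v : m → n → A} {Z : Matrix n n ℂ}
    (hv : ∀ i j, ∑ t, star (v t i) * v t j = algebraMap ℂ A ((1 - Zᴴ * Z) i j)) :
    ‖∑ t, star (rowMatrix r (v t)) * rowMatrix r (v t)‖ ≤ 1 := by
  let := CStarAlgebra.spectralOrder (CStarMatrix n n A)
  have := CStarAlgebra.spectralOrderedRing (CStarMatrix n n A)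
  let Z' : CStarMatrix n n A := CStarMatrix.ofMatrix (Z.map (algebraMap ℂ A))
  have h : ∑ t, star (rowMatrix r (v t)) * rowMatrix r (v t) = 1 - star Z' * Z' := by
    rw [sum_star_rowMatrix_mul_rowMatrix]
    ext i j
    change _ = (1 : CStarMatrix n n A) i j - (star Z' * Z') i j
    simp only [CStarMatrix.ofMatrix_apply, Matrix.of_apply, hv, CStarMatrix.mul_apply,
      CStarMatrix.star_apply, CStarMatrix.one_apply, Matrix.sub_apply, Matrix.one_apply,
      Matrix.mul_apply, Matrix.conjTranspose_apply, map_sub, map_sum, map_mul, Z',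
      Matrix.map_apply, algebraMap_star_comm]
    split_ifs <;> simp
  rw [CStarAlgebra.norm_le_one_iff_of_nonneg _
    (Finset.sum_nonneg fun t _ => star_mul_self_nonneg _), h]
  exact sub_le_self _ (star_mul_self_nonneg _)

theorem norm_ofMatrix_sum_star_mul_le_one {m : Type*} [Fintype m]
    {v w : m → n → A} {Z W : Matrix n n ℂ} [DecidableEq n]
    (hv : ∀ i j, ∑ t, star (v t i) * v t j = algebraMap ℂ A ((1 - Zᴴ * Z) i j))
    (hw : ∀ i j, ∑ t, star (w t i) * w t j = algebraMap ℂ A ((1 - Wᴴ * W) i j)) :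
    ‖CStarMatrix.ofMatrix (Matrix.of fun i j => ∑ t, star (v t i) * w t j)‖ ≤ 1 := by
  cases isEmpty_or_nonempty n
  · rw [show CStarMatrix.ofMatrix _ = (0 : CStarMatrix n n A) by ext i; exact isEmptyElim i,
      norm_zero]
    exact zero_le_one
  · let r := Classical.arbitrary n
    rw [← sum_star_rowMatrix_mul_rowMatrix r]
    refine (norm_sum_star_mul_le _ _).trans (mul_le_one₀ ?_ (Real.sqrt_nonneg _) ?_)
    · exact Real.sqrt_le_one.mpr (norm_sum_star_rowMatrix_mul_self_le_one r hv)
    · exact Real.sqrt_le_one.mpr (norm_sum_star_rowMatrix_mul_self_le_one r hw)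

open scoped ComplexOrder

omit [PartialOrder A] [StarOrderedRing A] in
theorem exists_normalization {m : Type*} [Fintype m] [DecidableEq n]
    {v : m → n → A} {P : Matrix n n ℂ} (hP : P.PosSemidef)
    (hv : ∀ i j, ∑ t, star (v t i) * v t j = algebraMap ℂ A (P i j)) {ε : ℝ} (hε : 0 < ε) :
    ∃ (S Z : Matrix n n ℂ) (v' : m → n → A), Sᴴ * S = P + (ε : ℂ) • 1 ∧
      (∀ t i, v t i = ∑ k, S k i • v' t k) ∧
      ∀ i j, ∑ t, star (v' t i) * v' t j = algebraMap ℂ A ((1 - Zᴴ * Z) i j) := by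
  obtain ⟨S, S', hS, hSS', hS'S⟩ := hP.exists_conjTranspose_mul_self_eq_add hε
  refine ⟨S, ((√ε : ℝ) : ℂ) • S', fun t k => ∑ i, S' i k • v t i, hS, fun t i => ?_, fun i j => ?_⟩
  · simp only [Finset.smul_sum, smul_smul]
    rw [Finset.sum_comm]
    simp only [← Finset.sum_smul]
    have (j : n) : ∑ k, S k i * S' j k = (1 : Matrix n n ℂ) j i := by
      rw [← hS'S, Matrix.mul_apply]
      simp only [mul_comm]
    simp only [this, Matrix.one_apply, ite_smul, one_smul, zero_smul, Finset.sum_ite_eq',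
      Finset.mem_univ, if_true]
  · rw [sum_star_sum_smul_mul_sum_smul]
    have h : S'ᴴ * P * S' = 1 - (((√ε : ℝ) : ℂ) • S')ᴴ * (((√ε : ℝ) : ℂ) • S') := by
      rw [eq_sub_of_add_eq hS.symm, mul_sub, sub_mul, ← mul_assoc, ← Matrix.conjTranspose_mul,
        mul_assoc, hSS', Matrix.conjTranspose_one, one_mul]
      simp [Matrix.conjTranspose_smul, smul_smul, Real.mul_self_sqrt hε.le]
    rw [← h]
    simp only [hv, Algebra.algebraMap_eq_smul_one, smul_smul, ← Finset.sum_smul, Matrix.mul_apply,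
      Finset.sum_mul, Matrix.conjTranspose_apply]
    rw [Finset.sum_comm]
    simp only [mul_right_comm]

variable {H : Type*} [NormedAddCommGroup H] [InnerProductSpace ℂ H] [CompleteSpace H]

omit [CompleteSpace H] in
theorem sum_norm_sum_smul_sq (S : Matrix n n ℂ) (h : n → H) :
    ((∑ k, ‖∑ i, S k i • h i‖ ^ 2 : ℝ) : ℂ) = ∑ i, ∑ j, (Sᴴ * S) i j * inner ℂ (h i) (h j) := by
  have (k : n) : ((‖∑ i, S k i • h i‖ ^ 2 : ℝ) : ℂ) =
      ∑ i, ∑ j, star (S k i) * S k j * inner ℂ (h i) (h j) := by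
    rw [Complex.ofReal_pow]
    refine (inner_self_eq_norm_sq_to_K (𝕜 := ℂ) (∑ i, S k i • h i)).symm.trans ?_
    simp only [sum_inner, inner_sum, inner_smul_left, inner_smul_right, starRingEnd_apply,
      Finset.mul_sum]
    rw [Finset.sum_comm]
    simp only [mul_left_comm, mul_assoc]
  simp only [Complex.ofReal_sum, this, Matrix.mul_apply, Finset.sum_mul,
    Matrix.conjTranspose_apply]
  exact Finset.sum_comm_cycle.symm

/-- Paulsen's off-diagonal estimate: a completely bounded map of norm at most `C` is dominated by
`C` times the inner product of `H`, on the operator system of the `2 × 2` matrices over `A` with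
scalar diagonal. -/
theorem norm_sum_inner_sum_star_mul_le {m : Type*} [Fintype m] {φ : A →ₗ[ℂ] (H →L[ℂ] H)} {C : ℝ}
    (hC : 0 ≤ C)
    (hφ : ∀ (n : ℕ) (x : Matrix (Fin n) (Fin n) A),
      cstarMatrixNorm (x.map φ) ≤ C * cstarMatrixNorm x)
    {v w : m → n → A} {P Q : Matrix n n ℂ} (hP : P.PosSemidef) (hQ : Q.PosSemidef)
    (hv : ∀ i j, ∑ t, star (v t i) * v t j = algebraMap ℂ A (P i j))
    (hw : ∀ i j, ∑ t, star (w t i) * w t j = algebraMap ℂ A (Q i j)) (h k : n → H) :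
    ‖∑ i, ∑ j, inner ℂ (h i) (φ (∑ t, star (v t i) * w t j) (k j))‖ ≤
      C / 2 * ((∑ i, ∑ j, P i j * inner ℂ (h i) (h j)).re +
        (∑ i, ∑ j, Q i j * inner ℂ (k i) (k j)).re) := by
  classical
  have bound (ε : ℝ) (hε : 0 < ε) :
      ‖∑ i, ∑ j, inner ℂ (h i) (φ (∑ t, star (v t i) * w t j) (k j))‖ ≤
        C / 2 * ((∑ i, ∑ j, P i j * inner ℂ (h i) (h j)).re +
          (∑ i, ∑ j, Q i j * inner ℂ (k i) (k j)).re) +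
        ε * (C / 2 * (∑ i, ‖h i‖ ^ 2 + ∑ i, ‖k i‖ ^ 2)) := by
    obtain ⟨S, Z, v', hS, hv', hZ⟩ := exists_normalization hP hv hε
    obtain ⟨T, W, w', hT, hw', hW⟩ := exists_normalization hQ hw hε
    have hy := norm_ofMatrix_sum_star_mul_le_one hZ hW
    have hle := norm_sum_inner_le_of_cstarMatrixNorm_le hφ
      (CStarMatrix.ofMatrix (Matrix.of fun i j => ∑ t, star (v' t i) * w' t j))
      (fun i => ∑ l, S i l • h l) (fun j => ∑ l, T j l • k l)
    have heq : ∑ i, ∑ j, inner ℂ (∑ l, S i l • h l)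
        (φ (CStarMatrix.ofMatrix (Matrix.of fun i j => ∑ t, star (v' t i) * w' t j) i j)
          (∑ l, T j l • k l)) =
        ∑ i, ∑ j, inner ℂ (h i) (φ (∑ t, star (v t i) * w t j) (k j)) := by
      simp only [hv', hw', sum_star_sum_smul_mul_sum_smul, map_sum, map_smul, sum_apply,
        smul_apply, inner_sum, inner_smul_right, sum_inner, inner_smul_left,
        CStarMatrix.ofMatrix_apply, Matrix.of_apply]
      rw [Finset.sum_comm_cycle]
      simp only [Finset.mul_sum]
      rw [Finset.sum_congr rfl fun b _ => (Finset.sum_congr rfl fun i _ =>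
        Finset.sum_congr rfl fun j _ => Finset.sum_comm).trans Finset.sum_comm_cycle,
        Finset.sum_comm]
      refine Finset.sum_congr rfl fun a _ => Finset.sum_congr rfl fun b _ =>
        Finset.sum_congr rfl fun i _ => Finset.sum_congr rfl fun j _ =>
        Finset.sum_congr rfl fun t _ => ?_
      rw [starRingEnd_apply]
      ring
    have hnorm (S P : Matrix n n ℂ) (h : n → H) (hS : Sᴴ * S = P + (ε : ℂ) • 1) :
        ∑ i, ‖∑ l, S i l • h l‖ ^ 2 =
          (∑ i, ∑ j, P i j * inner ℂ (h i) (h j)).re + ε * ∑ i, ‖h i‖ ^ 2 := by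
      rw [← Complex.ofReal_re (∑ i, ‖∑ l, S i l • h l‖ ^ 2), sum_norm_sum_smul_sq, hS]
      simp only [Matrix.add_apply, Matrix.smul_apply, Matrix.one_apply, add_mul,
        Finset.sum_add_distrib, Complex.add_re, smul_eq_mul, mul_ite, mul_one, mul_zero, ite_mul,
        zero_mul, Finset.sum_ite_eq, Finset.mem_univ, if_true, Complex.re_sum, Finset.mul_sum]
      simp [inner_self_eq_norm_sq_to_K, ← Complex.ofReal_pow]
    rw [heq] at hle
    refine hle.trans ?_
    have h1 := hnorm S P h hS
    have h2 := hnorm T Q k hT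
    set p := ∑ i, ‖∑ l, S i l • h l‖ ^ 2
    set q := ∑ i, ‖∑ l, T i l • k l‖ ^ 2
    have hp : 0 ≤ p := by positivity
    have hq : 0 ≤ q := by positivity
    have hpq : √p * √q ≤ (p + q) / 2 := by
      nlinarith [sq_nonneg (√p - √q), Real.sq_sqrt hp, Real.sq_sqrt hq]
    calc _ ≤ C * 1 * √p * √q := by gcongr
      _ = C * (√p * √q) := by ring
      _ ≤ C * ((p + q) / 2) := by gcongr
      _ = _ := by rw [h1, h2]; ring
  refine le_of_forall_pos_le_add fun δ hδ => ?_
  have hN : 0 ≤ C / 2 * (∑ i, ‖h i‖ ^ 2 + ∑ i, ‖k i‖ ^ 2) := by positivity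
  refine (bound (δ / (C / 2 * (∑ i, ‖h i‖ ^ 2 + ∑ i, ‖k i‖ ^ 2) + 1)) (by positivity)).trans ?_
  gcongr
  rw [div_mul_eq_mul_div, div_le_iff₀ (by positivity)]
  nlinarith
end OffDiagonal

section Kernel

variable {A : Type*} [CStarAlgebra A] {ι : Type*}

/-- The sesquilinear map `(u, v) ↦ (u i)* (v j)` with values in the finitely supported
matrices over `A`. -/
def kernelForm : (ι →₀ A) →ₗ⋆[ℂ] (ι →₀ A) →ₗ[ℂ] (ι × ι →₀ A) :=
  LinearMap.mk₂'ₛₗ (starRingEnd ℂ) (RingHom.id ℂ)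
    (fun u v => Finsupp.onFinset (u.support ×ˢ v.support) (fun p => star (u p.1) * v p.2)
      fun p hp => by
        simp only [Finset.mem_product, Finsupp.mem_support_iff]
        constructor <;> rintro h <;> simp [h] at hp)
    (fun u u' v => by ext p; simp [add_mul]) (fun c u v => by ext p; simp)
    (fun u v v' => by ext p; simp [mul_add]) (fun c u v => by ext p; simp)

@[simp]
theorem kernelForm_apply (u v : ι →₀ A) (p : ι × ι) :
    kernelForm u v p = star (u p.1) * v p.2 :=
  rfl

theorem kernelForm_smul (a : A) (u v : ι →₀ A) :
    kernelForm u (a • v) = kernelForm (star a • u) v := by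
  ext p
  simp [mul_assoc]

theorem kernelForm_single (i j : ι) (a b : A) :
    kernelForm (Finsupp.single i a) (Finsupp.single j b) = Finsupp.single (i, j) (star a * b) := by
  classical
  ext ⟨k, l⟩
  simp only [kernelForm_apply, Finsupp.single_apply, Prod.mk.injEq]
  split_ifs <;> simp_all

/-- The adjoint of finitely supported matrices over `A`. -/
def kernelStar : (ι × ι →₀ A) →ₗ⋆[ℂ] (ι × ι →₀ A) where
  toFun x := (x.mapRange star (star_zero A)).equivMapDomain (Equiv.prodComm ι ι)
  map_add' x y := by ext p; simp
  map_smul' c x := by ext p; simp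

@[simp]
theorem kernelStar_apply (x : ι × ι →₀ A) (p : ι × ι) : kernelStar x p = star (x p.swap) :=
  rfl

theorem kernelStar_kernelStar (x : ι × ι →₀ A) : kernelStar (kernelStar x) = x := by
  ext p
  simp

theorem kernelStar_kernelForm (u v : ι →₀ A) :
    kernelStar (kernelForm u v) = kernelForm v u := by
  ext p
  simp

theorem kernelStar_single (i j : ι) (a : A) :
    kernelStar (Finsupp.single (i, j) a) = Finsupp.single (j, i) (star a) := by
  rw [← one_mul a, ← star_one, ← kernelForm_single i j 1 a, kernelStar_kernelForm, kernelForm_single,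
    star_one, one_mul, mul_one]

/-- The positive cone of the finitely supported matrices over `A`. -/
def kernelCone (A ι : Type*) [CStarAlgebra A] : AddSubmonoid (ι × ι →₀ A) where
  carrier := {z | ∃ (m : ℕ) (u : Fin m → ι →₀ A), z = ∑ t, kernelForm (u t) (u t)}
  zero_mem' := ⟨0, 0, by simp⟩
  add_mem' := by
    rintro _ _ ⟨m, u, rfl⟩ ⟨m', u', rfl⟩
    exact ⟨m + m', Fin.append u u', by simp [Fin.sum_univ_add]⟩

theorem kernelForm_self_mem_kernelCone (u : ι →₀ A) : kernelForm u u ∈ kernelCone A ι :=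
  ⟨1, fun _ => u, by simp⟩

theorem smul_mem_kernelCone {r : ℝ} (hr : 0 ≤ r) {z : ι × ι →₀ A} (hz : z ∈ kernelCone A ι) :
    (r : ℂ) • z ∈ kernelCone A ι := by
  obtain ⟨m, u, rfl⟩ := hz
  refine ⟨m, fun t => ((√r : ℝ) : ℂ) • u t, ?_⟩
  simp only [Finset.smul_sum, map_smulₛₗ, Complex.conj_ofReal, LinearMap.smul_apply, smul_smul,
    RingHom.id_apply, ← Complex.ofReal_mul, Real.mul_self_sqrt hr]

theorem kernelStar_eq_self_of_mem {z : ι × ι →₀ A} (hz : z ∈ kernelCone A ι) :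
    kernelStar z = z := by
  obtain ⟨m, u, rfl⟩ := hz
  simp only [map_sum, kernelStar_kernelForm]

variable {β H : Type*}

/-- The finitely supported matrices over `A` whose diagonal blocks are scalar. -/
def scalarBlocks (A β H : Type*) [CStarAlgebra A] :
    Submodule ℂ ((β × H) × (β × H) →₀ A) where
  carrier := {x | ∀ b h k, x ((b, h), (b, k)) ∈ LinearMap.range (Algebra.linearMap ℂ A)}
  zero_mem' _ _ _ := zero_mem _
  add_mem' hx hy b h k := add_mem (hx b h k) (hy b h k)
  smul_mem' c _ hx b h k := Submodule.smul_mem _ c (hx b h k)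

theorem single_mem_scalarBlocks {b b' : β} (hb : b ≠ b') (h k : H) (a : A) :
    Finsupp.single ((b, h), (b', k)) a ∈ scalarBlocks A β H := by
  classical
  intro c h' k'
  rw [Finsupp.single_apply, if_neg]
  · exact zero_mem _
  · rintro h
    simp only [Prod.mk.injEq] at h
    exact hb (h.1.1.trans h.2.1.symm)

theorem single_one_mem_scalarBlocks (i j : β × H) :
    Finsupp.single (i, j) 1 ∈ scalarBlocks A β H := by
  classical
  intro c h k
  rw [Finsupp.single_apply]
  split_ifs
  · exact ⟨1, by simp⟩
  · exact zero_mem _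

theorem kernelStar_mem_scalarBlocks {x : (β × H) × (β × H) →₀ A} (hx : x ∈ scalarBlocks A β H) :
    kernelStar x ∈ scalarBlocks A β H := by
  intro b h k
  obtain ⟨c, hc⟩ := hx b k h
  refine ⟨star c, ?_⟩
  rw [kernelStar_apply, Prod.swap_prod_mk, ← hc]
  exact algebraMap_star_comm c

theorem exists_mem_scalarBlocks_add_mem_kernelCone (y : (β × H) × (β × H) →₀ A) :
    ∃ x ∈ scalarBlocks A β H, x + kernelStar x + (y + kernelStar y) ∈ kernelCone A (β × H) := by
  let := CStarAlgebra.spectralOrder A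
  have := CStarAlgebra.spectralOrderedRing A
  induction y using Finsupp.induction_linear with
  | zero => exact ⟨0, zero_mem _, by simp⟩
  | add y y' hy hy' =>
    obtain ⟨x, hx, hxy⟩ := hy
    obtain ⟨x', hx', hxy'⟩ := hy'
    refine ⟨x + x', add_mem hx hx', ?_⟩
    convert add_mem hxy hxy' using 1
    simp only [map_add]
    abel
  | single p a =>
    obtain ⟨i, j⟩ := p
    obtain ⟨c, hc⟩ := CStarAlgebra.nonneg_iff_eq_star_mul_self.mp
      (sub_nonneg.mpr (CStarAlgebra.mul_star_le_algebraMap_norm_sq (a := a)))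
    let x : (β × H) × (β × H) →₀ A := (1 / 2 : ℂ) • (Finsupp.single (j, j) 1 +
      Finsupp.single (i, i) (algebraMap ℝ A (‖a‖ ^ 2)))
    have hx : x + kernelStar x =
        Finsupp.single (j, j) 1 + Finsupp.single (i, i) (algebraMap ℝ A (‖a‖ ^ 2)) := by
      have hc : star (algebraMap ℝ A (‖a‖ ^ 2)) = algebraMap ℝ A (‖a‖ ^ 2) :=
        (IsSelfAdjoint.algebraMap A (.all _)).star_eq
      simp only [x, map_smulₛₗ, map_add, kernelStar_single, star_one, hc]
      rw [← add_smul, map_div₀, map_one, map_ofNat, add_halves, one_smul]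
    refine ⟨x, Submodule.smul_mem _ _ (add_mem (single_one_mem_scalarBlocks j j) ?_), ?_⟩
    · have := Submodule.smul_mem _ ((‖a‖ ^ 2 : ℝ) : ℂ) (single_one_mem_scalarBlocks (A := A) i i)
      rwa [Finsupp.smul_single, Complex.coe_smul, ← Algebra.algebraMap_eq_smul_one] at this
    · convert add_mem
        (kernelForm_self_mem_kernelCone (Finsupp.single i (star a) + Finsupp.single j 1))
        (kernelForm_self_mem_kernelCone (Finsupp.single i c)) using 1
      rw [hx]
      simp only [map_add, LinearMap.add_apply, kernelForm_single, ← hc, kernelStar_single,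
        star_star, star_one, one_mul, mul_one, Finsupp.single_sub]
      abel

end Kernel

section Functional

variable {A : Type*} [CStarAlgebra A]
  {H : Type*} [NormedAddCommGroup H] [InnerProductSpace ℂ H] [CompleteSpace H]

/-- The functional on finitely supported matrices over `A` with blocks indexed by `Bool`, given
by `⟨h, φ(a) k⟩` on the upper right block and by `C / 2` times it on the diagonal blocks. -/
def blockFunctional (φ : A →ₗ[ℂ] (H →L[ℂ] H)) (C : ℝ) :
    ((Bool × H) × (Bool × H) →₀ A) →ₗ[ℂ] ℂ :=
  Finsupp.lsum ℂ fun p =>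
    (if p.1.1 = p.2.1 then (C / 2 : ℂ) else if p.1.1 then 0 else 1) •
      ((innerSL ℂ p.1.2).toLinearMap ∘ₗ (ContinuousLinearMap.apply ℂ H p.2.2).toLinearMap ∘ₗ φ)

omit [CompleteSpace H] in
theorem blockFunctional_single (φ : A →ₗ[ℂ] (H →L[ℂ] H)) (C : ℝ) (b b' : Bool) (h k : H) (a : A) :
    blockFunctional φ C (Finsupp.single ((b, h), (b', k)) a) =
      (if b = b' then (C / 2 : ℂ) else if b then 0 else 1) * inner ℂ h (φ a k) := by
  simp only [blockFunctional, Finsupp.lsum_single, LinearMap.smul_apply, LinearMap.comp_apply,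
    ContinuousLinearMap.coe_coe, innerSL_apply_apply, ContinuousLinearMap.apply_apply, smul_eq_mul]

omit [CompleteSpace H] in
theorem blockFunctional_eq_sum (φ : A →ₗ[ℂ] (H →L[ℂ] H)) (C : ℝ)
    (z : (Bool × H) × (Bool × H) →₀ A) :
    ∃ s : Finset H, blockFunctional φ C z =
      C / 2 * ((∑ h : s, ∑ k : s, inner ℂ (h : H) (φ (z ((false, h), (false, k))) k)) +
        ∑ h : s, ∑ k : s, inner ℂ (h : H) (φ (z ((true, h), (true, k))) k)) +
      ∑ h : s, ∑ k : s, inner ℂ (h : H) (φ (z ((false, h), (true, k))) k) := by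
  classical
  let s : Finset H := z.support.image (fun p => p.1.2) ∪ z.support.image (fun p => p.2.2)
  have hs : z.support ⊆
      ((Finset.univ : Finset Bool) ×ˢ s) ×ˢ ((Finset.univ : Finset Bool) ×ˢ s) := by
    intro p hp
    simp only [Finset.mem_product, Finset.mem_univ, true_and]
    exact ⟨Finset.mem_union_left _ (Finset.mem_image_of_mem _ hp),
      Finset.mem_union_right _ (Finset.mem_image_of_mem _ hp)⟩
  refine ⟨s, ?_⟩
  rw [blockFunctional, Finsupp.lsum_apply, Finsupp.sum_of_support_subset z hs _ (by simp)]
  simp only [Finset.sum_product, Fintype.sum_bool]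
  have hsort (b b' : Bool) :
      ∑ h : s, ∑ k : s, inner ℂ (h : H) (φ (z ((b, h), (b', k))) k) =
        ∑ h ∈ s, ∑ k ∈ s, inner ℂ h (φ (z ((b, h), (b', k))) k) := by
    rw [← Finset.sum_coe_sort s]
    exact Finset.sum_congr rfl fun h _ =>
      Finset.sum_coe_sort s fun k => inner ℂ (h : H) (φ (z ((b, h), (b', k))) k)
  simp only [hsort, LinearMap.smul_apply, LinearMap.comp_apply, ContinuousLinearMap.coe_coe,
    innerSL_apply_apply, ContinuousLinearMap.apply_apply, smul_eq_mul]
  simp [← Finset.mul_sum, Finset.sum_add_distrib]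
  ring

open scoped ComplexOrder in
theorem blockFunctional_nonneg {φ : A →ₗ[ℂ] (H →L[ℂ] H)} (hφ1 : φ 1 = 1) {C : ℝ} (hC : 0 ≤ C)
    (hφ : ∀ (n : ℕ) (x : Matrix (Fin n) (Fin n) A),
      cstarMatrixNorm (x.map φ) ≤ C * cstarMatrixNorm x)
    {z : (Bool × H) × (Bool × H) →₀ A} (hz : z ∈ scalarBlocks A Bool H)
    (hz' : z ∈ kernelCone A (Bool × H)) : 0 ≤ (blockFunctional φ C z).re := by
  cases subsingleton_or_nontrivial A
  · simp [Subsingleton.elim z 0]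
  let := CStarAlgebra.spectralOrder A
  have := CStarAlgebra.spectralOrderedRing A
  obtain ⟨m, u, rfl⟩ := hz'
  obtain ⟨s, hs⟩ := blockFunctional_eq_sum φ C (∑ t, kernelForm (u t) (u t))
  have hsum (i j : Bool × H) :
      (∑ t, kernelForm (u t) (u t)) (i, j) = ∑ t, star (u t i) * u t j := by
    simp [Finsupp.finsetSum_apply]
  choose P hP using hz
  have hPos (b : Bool) : (Matrix.of fun h k : s => P b h k).PosSemidef :=
    posSemidef_of_sum_star_mul_eq_algebraMap (v := fun t (h : s) => u t (b, h)) fun h k => by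
      rw [← hsum]
      exact (hP b h k).symm
  have key := norm_sum_inner_sum_star_mul_le hC hφ (hPos false) (hPos true)
    (v := fun t (h : s) => u t (false, h)) (w := fun t (h : s) => u t (true, h))
    (fun h k => by rw [← hsum]; exact (hP false h k).symm)
    (fun h k => by rw [← hsum]; exact (hP true h k).symm) (fun h => h) (fun k => k)
  have hscalar (b : Bool) (h k : H) :
      inner ℂ h (φ ((∑ t, kernelForm (u t) (u t)) ((b, h), (b, k))) k) = P b h k * inner ℂ h k := by
    rw [← hP, Algebra.linearMap_apply, Algebra.algebraMap_eq_smul_one, map_smul, hφ1]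
    simp
  rw [hs]
  simp only [hscalar]
  simp only [← hsum] at key
  have := (abs_le.mp ((Complex.abs_re_le_norm _).trans key)).1
  simp only [Matrix.of_apply] at this
  rw [Complex.add_re, ← Complex.ofReal_ofNat, ← Complex.ofReal_div, Complex.re_ofReal_mul,
    Complex.add_re]
  linarith

theorem exists_dilationForm {φ : A →ₗ[ℂ] (H →L[ℂ] H)} (hφ1 : φ 1 = 1) {C : ℝ} (hC : 0 ≤ C)
    (hφ : ∀ (n : ℕ) (x : Matrix (Fin n) (Fin n) A),
      cstarMatrixNorm (x.map φ) ≤ C * cstarMatrixNorm x) :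
    ∃ p : (Bool × H →₀ A) →ₗ⋆[ℂ] (Bool × H →₀ A) →ₗ[ℂ] ℂ,
      (∀ u, 0 ≤ (p u u).re) ∧ (∀ u v, star (p v u) = p u v) ∧
      (∀ (a : A) u v, p u (a • v) = p (star a • u) v) ∧
      (∀ b h k, p (Finsupp.single (b, h) 1) (Finsupp.single (b, k) 1) = C * inner ℂ h k) ∧
      ∀ h k a, p (Finsupp.single (false, h) 1) (Finsupp.single (true, k) a) =
        inner ℂ h (φ a k) := by
  obtain ⟨F, hFP, hFC, hFσ⟩ := exists_hermitian_extension kernelStar kernelStar_kernelStar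
    (kernelCone A (Bool × H)) (fun r hr z hz => smul_mem_kernelCone hr hz)
    (fun z hz => kernelStar_eq_self_of_mem hz) (scalarBlocks A Bool H) (blockFunctional φ C)
    (fun x hx => kernelStar_mem_scalarBlocks hx)
    (fun z hz hz' => blockFunctional_nonneg hφ1 hC hφ hz hz')
    (fun y => by
      obtain ⟨x, hx, hxy⟩ := exists_mem_scalarBlocks_add_mem_kernelCone y
      refine ⟨x, hx, ?_⟩
      convert hxy)
  have hp (u v : Bool × H →₀ A) : kernelForm.compr₂ₛₗ F u v = F (kernelForm u v) := rfl
  refine ⟨kernelForm.compr₂ₛₗ F, fun u => hFC _ (kernelForm_self_mem_kernelCone u), fun u v => ?_,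
    fun a u v => ?_, fun b h k => ?_, fun h k a => ?_⟩
  · rw [hp, hp, ← hFσ, kernelStar_kernelForm]
  · rw [hp, hp, kernelForm_smul]
  · rw [hp, kernelForm_single, star_one, one_mul,
      hFP _ (single_one_mem_scalarBlocks _ _), kernelStar_single, star_one,
      blockFunctional_single, blockFunctional_single, hφ1]
    simp
    ring
  · rw [hp, kernelForm_single, star_one, one_mul,
      hFP _ (single_mem_scalarBlocks (by simp) _ _ _), kernelStar_single,
      blockFunctional_single, blockFunctional_single]
    simp

end Functional

section Dilation

/-- A map that scales inner products by `C` is a bounded linear map. -/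
theorem exists_continuousLinearMap_of_inner_eq {H K : Type*} [NormedAddCommGroup H]
    [InnerProductSpace ℂ H] [NormedAddCommGroup K] [InnerProductSpace ℂ K] {C : ℝ} {f : H → K}
    (hf : ∀ h k, inner ℂ (f h) (f k) = C * inner ℂ h k) :
    ∃ T : H →L[ℂ] K, ∀ h, T h = f h := by
  have hzero {x : K} (h : inner ℂ x x = (0 : ℂ)) : x = 0 := inner_self_eq_zero.mp h
  refine ⟨LinearMap.mkContinuous
    { toFun := f
      map_add' := fun h k => sub_eq_zero.mp (hzero ?_)
      map_smul' := fun c h => sub_eq_zero.mp (hzero ?_) } √C fun h => ?_, fun _ => rfl⟩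
  · simp only [inner_sub_left, inner_sub_right, inner_add_left, inner_add_right, hf]
    ring
  · simp only [inner_sub_left, inner_sub_right, inner_smul_left, inner_smul_right, hf,
      RingHom.id_apply]
    ring
  · refine le_of_eq ?_
    have h1 : ((‖f h‖ ^ 2 : ℝ) : ℂ) = ((C * ‖h‖ ^ 2 : ℝ) : ℂ) := by
      rw [Complex.ofReal_mul, Complex.ofReal_pow, Complex.ofReal_pow]
      exact (inner_self_eq_norm_sq_to_K (𝕜 := ℂ) (f h)).symm.trans
        ((hf h h).trans (congrArg _ (inner_self_eq_norm_sq_to_K h)))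
    have h2 := Complex.ofReal_injective h1
    change ‖f h‖ = _
    rw [← Real.sqrt_sq (norm_nonneg (f h)), h2, Real.sqrt_mul' _ (by positivity),
      Real.sqrt_sq (norm_nonneg h)]

theorem nonempty_repFactorization_of_norm_le.{u, v} {A : Type u} [CStarAlgebra A]
    {H : Type v} [NormedAddCommGroup H] [InnerProductSpace ℂ H] [CompleteSpace H]
    {φ : A →ₗ[ℂ] (H →L[ℂ] H)} (hφ1 : φ 1 = 1) {C : ℝ} (hC : 0 ≤ C)
    (hφ : ∀ (n : ℕ) (x : Matrix (Fin n) (Fin n) A),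
      cstarMatrixNorm (x.map φ) ≤ C * cstarMatrixNorm x) :
    Nonempty (RepFactorization A H φ) := by
  obtain ⟨p, hp, hsymm, hA, hdiag, hoff⟩ := exists_dilationForm hφ1 hC hφ
  obtain ⟨K, _, _, _, π, j, hj, hπ⟩ := exists_starAlgHom_of_form p hp hsymm hA
  have hgram (b : Bool) (h k : H) : inner ℂ (j (Finsupp.single (b, h) 1))
      (j (Finsupp.single (b, k) 1)) = C * inner ℂ h k := by
    rw [hj, hdiag]
  obtain ⟨T, hT⟩ := exists_continuousLinearMap_of_inner_eq (hgram false)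
  obtain ⟨Y, hY⟩ := exists_continuousLinearMap_of_inner_eq (hgram true)
  have hfac (a : A) : φ a = ContinuousLinearMap.adjoint T ∘L (π a ∘L Y) := by
    ext k
    refine ext_inner_left ℂ fun h => ?_
    rw [ContinuousLinearMap.comp_apply, ContinuousLinearMap.adjoint_inner_right,
      ContinuousLinearMap.comp_apply, hT, hY, hπ, hj, Finsupp.smul_single, smul_eq_mul, mul_one,
      hoff]
  exact ⟨{
    K := K
    π := LinearMap.mkContinuous π.toLinearMap 1 fun a => by
      rw [one_mul]
      exact NonUnitalStarAlgHom.norm_apply_le π a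
    X := ContinuousLinearMap.adjoint T
    Y := Y
    unital := map_one π
    starRep := ⟨map_mul π, map_star π⟩
    comp_eq_id := by
      have h := hfac 1
      rw [hφ1, map_one] at h
      exact h.symm
    factor := hfac }⟩

end Dilation

/-- **Hadwin.** A linear map `φ : A → B(H)` on a unital C*-algebra is unital and completely
bounded if and only if it factors as `φ(a) = Xπ(a)Y` with `π` a unital `*`-representation on
some Hilbert space `K` and bounded operators `X, Y` with `XY = I`. -/
theorem unital_cb_iff_repFactorization.{u, v}
    {A : Type u} [CStarAlgebra A]
    {H : Type v} [NormedAddCommGroup H] [InnerProductSpace ℂ H] [CompleteSpace H]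
    (φ : A →ₗ[ℂ] (H →L[ℂ] H)) :
    (φ 1 = 1 ∧ CompletelyBounded (⇑φ)) ↔ Nonempty (RepFactorization A H φ) := by
  refine ⟨fun ⟨h1, C, hC⟩ => ?_, fun ⟨R⟩ => ⟨R.map_one, R.completelyBounded⟩⟩
  refine nonempty_repFactorization_of_norm_le h1 (le_max_right C 0) fun n x => (hC n x).trans ?_
  exact mul_le_mul_of_nonneg_right (le_max_left C 0) (Real.sqrt_nonneg _)
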